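/- Let A and A' be unital associative ℂ-algebras such that A' has a countable basis as a ℂ-vector space. Let V be a simple module over the ℂ-algebra tensor product A ⊗_ℂ A'. Regard V as an A'-module via the algebra map a' ↦ 1 ⊗ a'. If V contains an A'-submodule M' which is a simple A'-module, then there exists a simple A-module M such that V is isomorphic to M ⊗_ℂ M' as A ⊗_ℂ A'-modules, where (a ⊗ a')·(m ⊗ m') = (a·m) ⊗ (a'·m'). -/

import Mathlib

open TensorProduct Cardinal

open Polynomial in
theorem aux_linInd
    {F E : Type*} [Field F] [DivisionRing E] [Algebra F E] {x : E} (H : Transcendental F x) :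
    LinearIndependent F fun a ↦ (x - algebraMap F E a)⁻¹ := by
  classical
  rw [transcendental_iff] at H
  refine linearIndependent_iff'.2 fun s m hm i hi ↦ ?_
  have hnz (a : F) : x - algebraMap F E a ≠ 0 := by
    intro h
    refine X_sub_C_ne_zero a (H (X - C a) ?_)
    rw [map_sub, aeval_X, aeval_C, h]
  have h1 : ∀ i ∈ s, aeval x (s.prod fun j ↦ (X - C j : F[X])) * (m i • (x - algebraMap F E i)⁻¹) =
      aeval x (C (m i) * (s.erase i).prod fun j ↦ (X - C j : F[X])) := fun i hi ↦ by
    have h3 : aeval x (X - C i : F[X]) = x - algebraMap F E i := by simp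
    rw [← s.prod_erase_mul _ hi, map_mul, h3, mul_smul_comm, mul_inv_cancel_right₀ (hnz i),
      map_mul, aeval_C, Algebra.smul_def]
  have hp : aeval x (∑ i ∈ s, C (m i) * (s.erase i).prod fun j ↦ (X - C j : F[X])) = 0 := by
    rw [map_sum, ← Finset.sum_congr rfl h1, ← Finset.mul_sum, hm, mul_zero]
  have h0 := congrArg (Polynomial.eval i) (H _ hp)
  rw [eval_finset_sum, Finset.sum_eq_single i] at h0
  · rw [eval_mul, eval_C, eval_prod, eval_zero] at h0
    refine (mul_eq_zero.1 h0).resolve_right (Finset.prod_ne_zero_iff.2 fun j hj ↦ ?_)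
    rw [eval_sub, eval_X, eval_C]
    exact sub_ne_zero.2 (Finset.ne_of_mem_erase hj).symm
  · intro j _ hji
    rw [eval_mul, eval_prod, Finset.prod_eq_zero (i := i), mul_zero]
    · exact Finset.mem_erase.2 ⟨hji.symm, hi⟩
    · simp
  · exact fun h => absurd hi h

theorem aux_div {D : Type} [DivisionRing D] [Algebra ℂ D] (h : Module.rank ℂ D ≤ ℵ₀) (d : D) :
    ∃ c : ℂ, algebraMap ℂ D c = d := by
  have : Algebra.IsAlgebraic ℂ D := by
    refine ⟨fun x => ?_⟩
    by_contra hx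
    have h2 := (aux_linInd (F := ℂ) (x := x) hx).cardinal_le_rank
    rw [Cardinal.mk_complex] at h2
    exact absurd (h2.trans h) (not_le.2 Cardinal.aleph0_lt_continuum)
  have : Algebra.IsIntegral ℂ D := Algebra.isAlgebraic_iff_isIntegral.1 this
  exact (IsAlgClosed.algebraMap_bijective_of_isIntegral (k := ℂ) (K := D)).2 d

section
variable {A' : Type} [Ring A'] [Algebra ℂ A']
    {M' : Type} [AddCommGroup M'] [Module ℂ M'] [Module A' M'] [IsScalarTower ℂ A' M']

theorem aux_schur (hcount : Module.rank ℂ A' ≤ ℵ₀) (hM' : IsSimpleModule A' M')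
    (d : M' →ₗ[A'] M') : ∃ c : ℂ, ∀ x, d x = c • x := by
  classical
  have hnt : Nontrivial M' := IsSimpleModule.nontrivial A' M'
  obtain ⟨m, hm⟩ := exists_ne (0 : M')
  have hsurj := IsSimpleModule.toSpanSingleton_surjective A' hm
  have h1 : Module.rank ℂ M' ≤ ℵ₀ :=
    (LinearMap.rank_le_of_surjective ((LinearMap.toSpanSingleton A' M' m).restrictScalars ℂ)
      hsurj).trans hcount
  have h2 : Module.rank ℂ (Module.End A' M') ≤ ℵ₀ := by
    refine le_trans (LinearMap.rank_le_of_injective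
      ({ toFun := fun f => f m, map_add' := fun _ _ => rfl, map_smul' := fun _ _ => rfl } :
        Module.End A' M' →ₗ[ℂ] M') ?_) h1
    intro f g hfg
    ext x
    obtain ⟨a, rfl⟩ := hsurj x
    have : f m = g m := hfg
    simp [this]
  obtain ⟨c, hc⟩ := aux_div h2 d
  refine ⟨c, fun x => ?_⟩
  rw [← hc]; rfl

variable {V : Type} [AddCommGroup V] [Module ℂ V] [Module A' V] [IsScalarTower ℂ A' V]

theorem aux_ind (hcount : Module.rank ℂ A' ≤ ℵ₀) (hM' : IsSimpleModule A' M')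
    {I : Type*} (f : I → (M' →ₗ[A'] V)) (hf : LinearIndependent ℂ f) (s : Finset I) :
    ∀ m : I → M', ∑ i ∈ s, f i (m i) = 0 → ∀ i ∈ s, m i = 0 := by
  classical
  induction s using Finset.induction_on with
  | empty => simp
  | insert j s hj ih =>
    intro m hm
    let N : Submodule A' M' :=
      { carrier := {x | ∃ n : I → M', f j x = ∑ i ∈ s, f i (n i)}
        add_mem' := by
          rintro x y ⟨n, hn⟩ ⟨n', hn'⟩
          exact ⟨n + n', by simp [hn, hn', Finset.sum_add_distrib]⟩
        zero_mem' := ⟨0, by simp⟩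
        smul_mem' := by
          rintro a x ⟨n, hn⟩
          exact ⟨a • n, by simp [hn, Finset.smul_sum]⟩ }
    have huniq : ∀ n n' : I → M', ∑ i ∈ s, f i (n i) = ∑ i ∈ s, f i (n' i) →
        ∀ i ∈ s, n i = n' i := by
      intro n n' h i hi
      have := ih (n - n') (by simp [h]) i hi
      exact sub_eq_zero.1 this
    rw [Finset.sum_insert hj] at hm
    rcases eq_bot_or_eq_top N with hN | hN
    · have hmj : m j = 0 := by
        have : m j ∈ N := ⟨-m, by simpa using eq_neg_of_add_eq_zero_left hm⟩
        rw [hN] at this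
        simpa using this
      rw [hmj, map_zero, zero_add] at hm
      intro i hi
      rcases Finset.mem_insert.1 hi with rfl | hi
      · exact hmj
      · exact ih m hm i hi
    · exfalso
      have hall : ∀ x, ∃ n : I → M', f j x = ∑ i ∈ s, f i (n i) := fun x => by
        have : x ∈ N := by rw [hN]; trivial
        exact this
      choose n hn using hall
      have hlin : ∀ i ∈ s, ∃ c : ℂ, ∀ x, n x i = c • x := by
        intro i hi
        refine aux_schur hcount hM'
          { toFun := fun x => n x i, map_add' := fun x y => ?_, map_smul' := fun a x => ?_ }
        · refine huniq (n (x + y)) (n x + n y) ?_ i hi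
          rw [← hn, map_add, hn x, hn y]; simp [Finset.sum_add_distrib]
        · refine huniq (n (a • x)) (a • n x) ?_ i hi
          rw [← hn, map_smul, hn x]; simp [Finset.smul_sum]
      choose! c hc using hlin
      have hfj : f j = ∑ i ∈ s, c i • f i := by
        ext x
        rw [hn, LinearMap.sum_apply]
        refine Finset.sum_congr rfl fun i hi => ?_
        rw [hc i hi, LinearMap.smul_apply, LinearMap.map_smul_of_tower]
      refine hf.notMem_span_image (s := (s : Set I)) (x := j) (by simpa using hj) ?_
      rw [hfj]
      exact Submodule.sum_mem _ fun i hi => Submodule.smul_mem _ _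
        (Submodule.subset_span ⟨i, hi, rfl⟩)

/-- evaluation -/
noncomputable def auxEv : (M' →ₗ[A'] V) ⊗[ℂ] M' →ₗ[ℂ] V :=
  TensorProduct.lift
    { toFun := fun f => f.restrictScalars ℂ
      map_add' := fun _ _ => rfl
      map_smul' := fun _ _ => rfl }

@[simp] theorem auxEv_tmul (f : M' →ₗ[A'] V) (m : M') :
    auxEv (f ⊗ₜ[ℂ] m) = f m := rfl

theorem auxEv_inj (hcount : Module.rank ℂ A' ≤ ℵ₀) (hM' : IsSimpleModule A' M') :
    Function.Injective (auxEv : (M' →ₗ[A'] V) ⊗[ℂ] M' →ₗ[ℂ] V) := by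
  classical
  rw [injective_iff_map_eq_zero]
  intro x hx
  let b := Module.Basis.ofVectorSpace ℂ (M' →ₗ[A'] V)
  obtain ⟨y, rfl⟩ := (TensorProduct.equivFinsuppOfBasisLeft (N := M') b).symm.surjective x
  rw [TensorProduct.equivFinsuppOfBasisLeft_symm_apply, Finsupp.sum, map_sum] at hx
  simp only [auxEv_tmul] at hx
  have := aux_ind hcount hM' b b.linearIndependent y.support y hx
  have hy : y = 0 := by
    ext i
    by_contra h
    exact h (this i (Finsupp.mem_support_iff.2 h))
  simp [hy]

variable {A : Type} [Ring A] [Algebra ℂ A] [Module A V] [IsScalarTower ℂ A V]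
  [SMulCommClass A' A V] [Module (A ⊗[ℂ] A') V]

theorem auxEv_surj (hT : ∀ (a : A) (a' : A') (v : V), (a ⊗ₜ[ℂ] a') • v = a • a' • v)
    (hV : IsSimpleModule (A ⊗[ℂ] A') V) (N : Submodule A (M' →ₗ[A'] V)) (hN : N ≠ ⊥) :
    Function.Surjective (auxEv ∘ₗ (N.subtype.restrictScalars ℂ).rTensor M' :
      N ⊗[ℂ] M' →ₗ[ℂ] V) := by
  set g : N ⊗[ℂ] M' →ₗ[ℂ] V := auxEv ∘ₗ (N.subtype.restrictScalars ℂ).rTensor M' with hg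
  have hgt : ∀ (f : N) (m : M'), g (f ⊗ₜ m) = f.1 m := fun f m => rfl
  let S : Submodule (A ⊗[ℂ] A') V :=
    { carrier := Set.range g
      add_mem' := by rintro _ _ ⟨x, rfl⟩ ⟨y, rfl⟩; exact ⟨x + y, map_add _ _ _⟩
      zero_mem' := ⟨0, map_zero _⟩
      smul_mem' := by
        rintro t _ ⟨x, rfl⟩
        change t • g x ∈ LinearMap.range g
        induction t with
        | zero => rw [zero_smul]; exact zero_mem _
        | add t u ht hu => rw [add_smul]; exact add_mem ht hu
        | tmul a a' =>
          induction x with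
          | zero => rw [map_zero, smul_zero]; exact zero_mem _
          | add x y hx hy => rw [map_add, smul_add]; exact add_mem hx hy
          | tmul f m =>
            refine ⟨(a • f) ⊗ₜ (a' • m), ?_⟩
            rw [hgt, hgt, hT, ← map_smul]; rfl }
  have hS : S = ⊤ := by
    refine (eq_bot_or_eq_top S).resolve_left fun h => hN ?_
    rw [eq_bot_iff]
    intro f hf
    rw [Submodule.mem_bot]
    ext m
    have : f m ∈ S := ⟨(⟨f, hf⟩ : N) ⊗ₜ m, hgt _ _⟩
    rw [h] at this
    simpa using this
  intro v
  have : v ∈ S := by rw [hS]; trivial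
  exact this

theorem aux_main (hcount : Module.rank ℂ A' ≤ ℵ₀) (hM' : IsSimpleModule A' M')
    (hT : ∀ (a : A) (a' : A') (v : V), (a ⊗ₜ[ℂ] a') • v = a • a' • v)
    (hV : IsSimpleModule (A ⊗[ℂ] A') V) (ι : M' →ₗ[A'] V) (hι : Function.Injective ι) :
    IsSimpleModule A (M' →ₗ[A'] V) ∧
    Function.Bijective (auxEv : (M' →ₗ[A'] V) ⊗[ℂ] M' →ₗ[ℂ] V) := by
  have hnt : Nontrivial M' := IsSimpleModule.nontrivial A' M'
  have hinj := auxEv_inj (V := V) hcount hM'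
  have hι0 : ι ≠ 0 := by
    rintro rfl
    obtain ⟨m, hm⟩ := exists_ne (0 : M')
    exact hm (hι (by simp))
  have : Nontrivial (M' →ₗ[A'] V) := ⟨ι, 0, hι0⟩
  refine ⟨?_, hinj, ?_⟩
  · rw [isSimpleModule_iff]
    refine { eq_bot_or_eq_top := fun N => or_iff_not_imp_left.2 fun hN => ?_ }
    have h := auxEv_surj hT hV N hN
    have h1 : Function.Surjective ((N.subtype.restrictScalars ℂ).rTensor M') := by
      intro x
      obtain ⟨y, hy⟩ := h (auxEv x)
      exact ⟨y, hinj hy⟩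
    have h2 : Function.Surjective ((N.subtype.restrictScalars ℂ).lTensor M') := by
      rw [← LinearMap.comm_comp_rTensor_comp_comm_eq]
      simpa using h1
    rw [Module.FaithfullyFlat.lTensor_surjective_iff_surjective] at h2
    rw [eq_top_iff]
    intro f _
    obtain ⟨y, rfl⟩ := h2 f
    exact y.2
  · intro v
    obtain ⟨y, hy⟩ := auxEv_surj (M' := M') hT hV ⊤ top_ne_bot v
    exact ⟨_, hy⟩

end


open TensorProduct Cardinal

/-- Let `A` and `A'` be unital associative `ℂ`-algebras such that `A'` has a
countable basis as a `ℂ`-vector space (equivalently, `Module.rank ℂ A' ≤ ℵ₀`). Let `V` be a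
simple `A ⊗[ℂ] A'`-module, regarded as an `A'`-module via `a' ↦ 1 ⊗ a'`. If `V` contains an
`A'`-submodule `M'` (presented here as an injective `A'`-linear map `ι : M' →ₗ[A'] V`) which is a
simple `A'`-module, then there is a simple `A`-module `M` such that `V ≅ M ⊗[ℂ] M'` as
`A ⊗[ℂ] A'`-modules, where the module structure on the tensor product is the natural one
determined by `(a ⊗ a') • (m ⊗ m') = (a • m) ⊗ (a' • m')`. -/
theorem simple_module_over_tensor_is_tensor
    (A A' : Type) [Ring A] [Algebra ℂ A] [Ring A'] [Algebra ℂ A']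
    (hcount : Module.rank ℂ A' ≤ ℵ₀)
    (V : Type) [AddCommGroup V] [Module (A ⊗[ℂ] A') V]
    (hV : IsSimpleModule (A ⊗[ℂ] A') V)
    [Module A' V]
    (hVact : ∀ (a' : A') (v : V), a' • v = ((1 : A) ⊗ₜ[ℂ] a') • v)
    (M' : Type) [AddCommGroup M'] [Module ℂ M'] [Module A' M'] [IsScalarTower ℂ A' M']
    (hM' : IsSimpleModule A' M')
    (ι : M' →ₗ[A'] V) (hι : Function.Injective ι) :
    ∃ (M : Type) (_ : AddCommGroup M) (_ : Module ℂ M) (_ : Module A M)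
      (_ : IsScalarTower ℂ A M),
      IsSimpleModule A M ∧
      ∃ _ : Module (A ⊗[ℂ] A') (M ⊗[ℂ] M'),
        (∀ (a : A) (a' : A') (m : M) (m' : M'),
          (a ⊗ₜ[ℂ] a') • (m ⊗ₜ[ℂ] m') = (a • m) ⊗ₜ[ℂ] (a' • m')) ∧
        Nonempty (V ≃ₗ[A ⊗[ℂ] A'] (M ⊗[ℂ] M')) := by
  letI : Module A V := Module.compHom V
    (Algebra.TensorProduct.includeLeft : A →ₐ[ℂ] A ⊗[ℂ] A').toRingHom
  letI : Module ℂ V := Module.compHom V (algebraMap ℂ (A ⊗[ℂ] A'))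
  have hA : ∀ (a : A) (v : V), a • v = (a ⊗ₜ[ℂ] (1 : A')) • v := fun _ _ => rfl
  have hC : ∀ (c : ℂ) (v : V), c • v = (algebraMap ℂ (A ⊗[ℂ] A') c) • v := fun _ _ => rfl
  haveI : IsScalarTower ℂ A V := ⟨fun c a v => by
    rw [hA, hA, hC, ← mul_smul, ← Algebra.smul_def, TensorProduct.smul_tmul']⟩
  haveI : IsScalarTower ℂ A' V := ⟨fun c a v => by
    rw [hVact, hVact, hC, ← mul_smul, ← Algebra.smul_def, TensorProduct.tmul_smul]⟩
  haveI : SMulCommClass A' A V := ⟨fun a' a v => by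
    rw [hVact, hVact, hA, hA, ← mul_smul, ← mul_smul]; simp⟩
  have hT : ∀ (a : A) (a' : A') (v : V), (a ⊗ₜ[ℂ] a') • v = a • a' • v := fun a a' v => by
    rw [hVact, hA, ← mul_smul]; simp
  obtain ⟨hs, hb⟩ := aux_main hcount hM' hT hV ι hι
  let e : (M' →ₗ[A'] V) ⊗[ℂ] M' ≃+ V :=
    (LinearEquiv.ofBijective (auxEv : (M' →ₗ[A'] V) ⊗[ℂ] M' →ₗ[ℂ] V) hb).toAddEquiv
  refine ⟨M' →ₗ[A'] V, inferInstance, inferInstance, inferInstance, inferInstance, hs, ?_⟩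
  letI m : Module (A ⊗[ℂ] A') ((M' →ₗ[A'] V) ⊗[ℂ] M') := e.module (A ⊗[ℂ] A')
  have hsm : ∀ (t : A ⊗[ℂ] A') (x : (M' →ₗ[A'] V) ⊗[ℂ] M'), e (t • x) = t • e x :=
    fun t x => e.apply_symm_apply _
  refine ⟨m, fun a a' f x => ?_, ⟨LinearEquiv.symm { e with map_smul' := hsm }⟩⟩
  apply e.injective
  rw [hsm]
  change (a ⊗ₜ[ℂ] a') • f x = a • f (a' • x)
  rw [hT, map_smul]
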